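/- Suppose 𝒜 is normal, i.e. |𝒜_X| = codim(X) for every X ∈ L(𝒜). Then: (a) for every maximal X ∈ L, nbc_X = {B ∈ nbc : ⋂B = X} is a singleton (hence every linear order on 𝒜 is unmixed); (b) for every B = (H_{i_1}, …, H_{i_r}) ∈ βnbc(𝒜) and every λ ∈ ℂ^n, Ξ(B) = λ_{i_1} λ_{i_2} ⋯ λ_{i_r} · ω_B in A^r. -/

import Mathlib

open Module

noncomputable section

/-- An arrangement of `n` (affine) hyperplanes inside the ambient affine subspace `amb`
of the complex vector space `W`.  The linear order on the hyperplanes is the order of the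
indices in `Fin n`; an arbitrary linear order is encoded by a permutation `σ` of `Fin n`,
with `i ≺ j ↔ σ i < σ j`. -/
structure HArr (W : Type) [AddCommGroup W] [Module ℂ W] (n : ℕ) where
  amb : AffineSubspace ℂ W
  amb_ne : (amb : Set W).Nonempty
  H : Fin n → AffineSubspace ℂ W
  inj : Function.Injective H
  le_amb : ∀ i, H i ≤ amb
  nonemptyH : ∀ i, ((H i : Set W)).Nonempty
  hyp : ∀ i, finrank ℂ (H i).direction + 1 = finrank ℂ amb.direction

namespace HArr

variable {W : Type} [AddCommGroup W] [Module ℂ W] {n : ℕ}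

/-- The intersection `⋂ S` of a subset of the arrangement (the ambient space for `S = ∅`). -/
def inter (A : HArr W n) (S : Finset (Fin n)) : AffineSubspace ℂ W :=
  A.amb ⊓ S.inf A.H

/-- Codimension (inside the ambient space) of an affine subspace. -/
def cd (A : HArr W n) (X : AffineSubspace ℂ W) : ℕ :=
  finrank ℂ A.amb.direction - finrank ℂ X.direction

/-- A dependent subset of the arrangement. -/
def dep (A : HArr W n) (S : Finset (Fin n)) : Prop :=
  A.inter S ≠ ⊥ ∧ A.cd (A.inter S) < S.card

/-- An independent subset of the arrangement. -/
def indep (A : HArr W n) (S : Finset (Fin n)) : Prop :=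
  A.inter S ≠ ⊥ ∧ A.cd (A.inter S) = S.card

/-- A base: a maximal independent subset. -/
def isBase (A : HArr W n) (S : Finset (Fin n)) : Prop :=
  A.indep S ∧ ∀ T, A.indep T → S ⊆ T → S = T

open scoped Classical in
/-- The rank of a subarrangement `{H i : i ∈ C}`. -/
def rankOn (A : HArr W n) (C : Finset (Fin n)) : ℕ :=
  C.powerset.sup fun S => if A.indep S then S.card else 0

/-- The rank `r` of the arrangement. -/
def rank (A : HArr W n) : ℕ := A.rankOn Finset.univ

/-- A circuit: an inclusion-minimal dependent set. -/
def circuit (A : HArr W n) (S : Finset (Fin n)) : Prop :=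
  A.dep S ∧ ∀ T ⊂ S, ¬ A.dep T

/-- A broken circuit w.r.t. the linear order given by `σ`. -/
def brokenCircuit (A : HArr W n) (σ : Equiv.Perm (Fin n)) (S : Finset (Fin n)) : Prop :=
  ∃ i ∉ S, (∀ j ∈ S, σ i < σ j) ∧ A.circuit (insert i S)

/-- An nbc set: nonempty intersection and containing no broken circuit. -/
def nbcSet (A : HArr W n) (σ : Equiv.Perm (Fin n)) (S : Finset (Fin n)) : Prop :=
  A.inter S ≠ ⊥ ∧ ∀ T ⊆ S, ¬ A.brokenCircuit σ T

/-- An nbc-base. -/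
def nbcBase (A : HArr W n) (σ : Equiv.Perm (Fin n)) (S : Finset (Fin n)) : Prop :=
  A.nbcSet σ S ∧ A.isBase S

/-- A βnbc-base. -/
def betaNbcBase (A : HArr W n) (σ : Equiv.Perm (Fin n)) (S : Finset (Fin n)) : Prop :=
  A.nbcBase σ S ∧ ∀ i ∈ S, ∃ j, σ j < σ i ∧ A.isBase (insert j (S.erase i))

/-- Membership in the intersection poset `L(𝒜)`. -/
def memL (A : HArr W n) (X : AffineSubspace ℂ W) : Prop :=
  X ≠ ⊥ ∧ ∃ S : Finset (Fin n), A.inter S = X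

/-- A maximal element of `L(𝒜)` (in the reverse-inclusion order). -/
def maximalL (A : HArr W n) (X : AffineSubspace ℂ W) : Prop :=
  A.memL X ∧ ∀ Y, A.memL Y → Y ≤ X → Y = X

open scoped Classical in
/-- The set of indices of hyperplanes containing `X`, i.e. `𝒜_X`. -/
def sub (A : HArr W n) (X : AffineSubspace ℂ W) : Finset (Fin n) :=
  Finset.univ.filter fun i => X ≤ A.H i

/-- `X` is dense: `𝒜_X` admits no decomposition into two nonempty parts. -/
def denseL (A : HArr W n) (X : AffineSubspace ℂ W) : Prop :=
  ¬ ∃ S T : Finset (Fin n), Disjoint S T ∧ S.Nonempty ∧ T.Nonempty ∧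
      S ∪ T = A.sub X ∧ A.cd (A.inter S) + A.cd (A.inter T) = A.cd X

/-- `i` is the minimum of `S` w.r.t. the linear order given by `σ`. -/
def isMin (σ : Equiv.Perm (Fin n)) (i : Fin n) (S : Finset (Fin n)) : Prop :=
  i ∈ S ∧ ∀ j ∈ S, σ i ≤ σ j

/-- The standard ordered tuple of a finite set, w.r.t. the linear order given by `σ`:
`tup σ S p` is the element of `S` with `(p+1)`-st smallest `σ`-value. -/
def tup (σ : Equiv.Perm (Fin n)) (S : Finset (Fin n)) (p : Fin S.card) : Fin n :=
  σ.symm (((S.image ⇑σ).orderIsoOfFin (Finset.card_image_of_injective S σ.injective) p).1)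

/-- The flag `ξ(B) = (X_1 > ⋯ > X_r)` of a standard ordered base:
`flag σ S p = X_{p+1} = ⋂_{k ≥ p} H_{i_k}`. -/
def flag (A : HArr W n) (σ : Equiv.Perm (Fin n)) (S : Finset (Fin n)) (p : Fin S.card) :
    AffineSubspace ℂ W :=
  A.inter (S.filter fun i => σ (tup σ S p) ≤ σ i)

/-- Lexicographic order on standard ordered tuples (for the canonical order). -/
def lexLt (S T : Finset (Fin n)) : Prop :=
  List.Lex (· < ·) (S.sort (· ≤ ·)) (T.sort (· ≤ ·))

/-- `λ(X) = Σ_{H_i ∈ 𝒜_X} λ_i`. -/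
def lamX (A : HArr W n) (lam : Fin n → ℂ) (X : AffineSubspace ℂ W) : ℂ :=
  ∑ i ∈ A.sub X, lam i

/-- `X` is unmixed (w.r.t. the order `σ`). -/
def unmixedX (A : HArr W n) (σ : Equiv.Perm (Fin n)) (X : AffineSubspace ℂ W) : Prop :=
  (∀ S, A.nbcBase σ S → A.inter S = X → A.betaNbcBase σ S) ∨
  (∀ S, A.nbcBase σ S → A.inter S = X → ¬ A.betaNbcBase σ S)

/-- The linear order given by `σ` is unmixed. -/
def unmixedOrd (A : HArr W n) (σ : Equiv.Perm (Fin n)) : Prop :=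
  ∀ X, A.maximalL X → A.unmixedX σ X

/-- Membership in the intersection poset of the deleted arrangement `𝒜 ∖ {H_{i₀}}`. -/
def memLdel (A : HArr W n) (i₀ : Fin n) (X : AffineSubspace ℂ W) : Prop :=
  X ≠ ⊥ ∧ ∃ S : Finset (Fin n), i₀ ∉ S ∧ A.inter S = X

/-- A maximal element of the intersection poset of the deleted arrangement. -/
def maximalLdel (A : HArr W n) (i₀ : Fin n) (X : AffineSubspace ℂ W) : Prop :=
  A.memLdel i₀ X ∧ ∀ Y, A.memLdel i₀ Y → Y ≤ X → Y = X

/-- The generator `e_i` of the exterior algebra `E`. -/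
def gen (i : Fin n) : ExteriorAlgebra ℂ (Fin n → ℂ) :=
  ExteriorAlgebra.ι ℂ (Pi.single i 1)

/-- `e_S = e_{i_1} ∧ ⋯ ∧ e_{i_p}` for `S = {i_1 < ⋯ < i_p}`. -/
def eS (S : Finset (Fin n)) : ExteriorAlgebra ℂ (Fin n → ℂ) :=
  ((S.sort (· ≤ ·)).map gen).prod

/-- `∂e_S = Σ_k (−1)^{k−1} e_{S ∖ {i_k}}`. -/
def bdry (S : Finset (Fin n)) : ExteriorAlgebra ℂ (Fin n → ℂ) :=
  ∑ i ∈ S, ((-1 : ℂ) ^ (S.filter fun j => j < i).card) • eS (S.erase i)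

/-- The defining relations of the Orlik–Solomon algebra. -/
inductive OSRel (A : HArr W n) :
    ExteriorAlgebra ℂ (Fin n → ℂ) → ExteriorAlgebra ℂ (Fin n → ℂ) → Prop
  | isBot : ∀ S : Finset (Fin n), A.inter S = ⊥ → OSRel A (eS S) 0
  | isDep : ∀ S : Finset (Fin n), A.dep S → OSRel A (bdry S) 0

/-- The Orlik–Solomon algebra `A(𝒜)`: the exterior algebra modulo the ideal generated by
the `e_S` with empty intersection and the `∂e_S` with `S` dependent. -/
abbrev OS (A : HArr W n) := RingQuot (OSRel A)

/-- The quotient map `E → A(𝒜)`. -/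
def osMk (A : HArr W n) : ExteriorAlgebra ℂ (Fin n → ℂ) →ₐ[ℂ] OS A :=
  RingQuot.mkAlgHom ℂ (OSRel A)

/-- `ω_i`, the image of `e_i` in the Orlik–Solomon algebra. -/
def om (A : HArr W n) (i : Fin n) : OS A := osMk A (gen i)

/-- `ω_B`, the image of `e_B` in the Orlik–Solomon algebra. -/
def omB (A : HArr W n) (S : Finset (Fin n)) : OS A := osMk A (eS S)

/-- The degree `p` part `A^p` of the Orlik–Solomon algebra. -/
def deg (A : HArr W n) (p : ℕ) : Submodule ℂ (OS A) :=
  Submodule.span ℂ {x | ∃ S : Finset (Fin n), S.card = p ∧ x = omB A S}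

/-- `ω_λ = Σ_i λ_i ω_i`. -/
def omLam (A : HArr W n) (lam : Fin n → ℂ) : OS A := ∑ i, lam i • om A i

/-- `ω_λ(X) = Σ_{H_i ∈ 𝒜_X} λ_i ω_i`. -/
def omLamX (A : HArr W n) (lam : Fin n → ℂ) (X : AffineSubspace ℂ W) : OS A :=
  ∑ i ∈ A.sub X, lam i • om A i

/-- The form `Ξ(B) = ω_λ(X_1) ⋯ ω_λ(X_r)` attached to a standard ordered base. -/
def Xi (A : HArr W n) (σ : Equiv.Perm (Fin n)) (lam : Fin n → ℂ) (S : Finset (Fin n)) :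
    OS A :=
  ((List.finRange S.card).map fun p => A.omLamX lam (A.flag σ S p)).prod

/-- The submodule `ω_λ ∧ A^p` of the Orlik-Solomon algebra. -/
def Ideg (A : HArr W n) (lam : Fin n → ℂ) (p : ℕ) : Submodule ℂ (OS A) :=
  (A.deg p).map (LinearMap.mulLeft ℂ (A.omLam lam))

end HArr

namespace HArr

variable {W : Type} [AddCommGroup W] [Module ℂ W] {n : ℕ}

theorem mem_sub {A : HArr W n} {X : AffineSubspace ℂ W} {i : Fin n} :
    i ∈ A.sub X ↔ X ≤ A.H i := by
  simp [sub]

theorem inter_anti (A : HArr W n) {S T : Finset (Fin n)} (h : S ⊆ T) :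
    A.inter T ≤ A.inter S :=
  inf_le_inf_left _ (Finset.inf_mono h)

theorem subset_sub_inter (A : HArr W n) (S : Finset (Fin n)) : S ⊆ A.sub (A.inter S) :=
  fun _ hi => mem_sub.2 (inf_le_right.trans (Finset.inf_le hi))

theorem inter_ne_bot_of_subset (A : HArr W n) {S T : Finset (Fin n)} (h : S ⊆ T)
    (hT : A.inter T ≠ ⊥) : A.inter S ≠ ⊥ :=
  fun hS => hT (le_bot_iff.1 (hS ▸ A.inter_anti h))

theorem inter_insert (A : HArr W n) (i : Fin n) (S : Finset (Fin n)) :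
    A.inter (insert i S) = A.inter S ⊓ A.H i := by
  rw [inter, inter, Finset.inf_insert, inf_comm (A.H i), inf_assoc]

/-- Each hyperplane lowers the dimension of a nonempty intersection by at most one. -/
theorem finrank_amb_le_finrank_inter_add_card [FiniteDimensional ℂ W] (A : HArr W n)
    (S : Finset (Fin n)) (hS : A.inter S ≠ ⊥) :
    finrank ℂ A.amb.direction ≤ finrank ℂ (A.inter S).direction + S.card := by
  induction S using Finset.induction_on with
  | empty => rw [inter, Finset.inf_empty, inf_top_eq, Finset.card_empty, add_zero]
  | insert i S hi ih =>
    have hbound := ih (A.inter_ne_bot_of_subset (Finset.subset_insert i S) hS)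
    rw [inter_insert] at hS ⊢
    obtain ⟨p, hp⟩ := (AffineSubspace.nonempty_iff_ne_bot _).2 hS
    rw [AffineSubspace.direction_inf_of_mem hp.1 hp.2, Finset.card_insert_of_notMem hi]
    have hdim := Submodule.finrank_sup_add_finrank_inf_eq
      (A.inter S).direction (A.H i).direction
    have hsup : finrank ℂ ↥((A.inter S).direction ⊔ (A.H i).direction) ≤
        finrank ℂ A.amb.direction :=
      Submodule.finrank_mono (sup_le (AffineSubspace.direction_le inf_le_left)
        (AffineSubspace.direction_le (A.le_amb i)))
    have hhyp := A.hyp i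
    omega

theorem cd_inter_le_card [FiniteDimensional ℂ W] (A : HArr W n)
    (S : Finset (Fin n)) (hS : A.inter S ≠ ⊥) : A.cd (A.inter S) ≤ S.card := by
  have h := A.finrank_amb_le_finrank_inter_add_card S hS
  unfold cd
  omega

/-- `𝒜` is normal: `|𝒜_X| = codim X` for every `X ∈ L(𝒜)`. -/
def Normal (A : HArr W n) : Prop :=
  ∀ X, A.memL X → (A.sub X).card = A.cd X

namespace Normal

variable [FiniteDimensional ℂ W] {A : HArr W n} {S : Finset (Fin n)}

theorem sub_inter (hA : A.Normal) (hS : A.inter S ≠ ⊥) : A.sub (A.inter S) = S := by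
  refine (Finset.eq_of_subset_of_card_le (A.subset_sub_inter S) ?_).symm
  rw [hA _ ⟨hS, S, rfl⟩]
  exact A.cd_inter_le_card S hS

theorem indep (hA : A.Normal) (hS : A.inter S ≠ ⊥) : A.indep S := by
  refine ⟨hS, ?_⟩
  rw [← hA _ ⟨hS, S, rfl⟩, hA.sub_inter hS]

theorem not_dep (hA : A.Normal) (S : Finset (Fin n)) : ¬ A.dep S :=
  fun h => h.2.ne (hA.indep h.1).2

theorem nbcBase_iff (hA : A.Normal) (σ : Equiv.Perm (Fin n)) : A.nbcBase σ S ↔ A.isBase S :=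
  ⟨fun h => h.2, fun h => ⟨⟨h.1.1, fun _ _ ⟨_, _, _, hc⟩ => hA.not_dep _ hc.1⟩, h⟩⟩

theorem existsUnique_nbcBase (hA : A.Normal) (σ : Equiv.Perm (Fin n))
    {X : AffineSubspace ℂ W} (hX : A.maximalL X) :
    ∃! S : Finset (Fin n), A.nbcBase σ S ∧ A.inter S = X := by
  obtain ⟨⟨hne, S, rfl⟩, hmax⟩ := hX
  refine ⟨S, ⟨(hA.nbcBase_iff σ).2 ⟨hA.indep hne, fun T hT hST => ?_⟩, rfl⟩, ?_⟩
  · rw [← hA.sub_inter hne, ← hmax _ ⟨hT.1, T, rfl⟩ (A.inter_anti hST), hA.sub_inter hT.1]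
  · rintro T ⟨hT, hTS⟩
    rw [← hA.sub_inter hne, ← hTS, hA.sub_inter hT.1.1]

theorem unmixedOrd (hA : A.Normal) (σ : Equiv.Perm (Fin n)) : A.unmixedOrd σ := by
  intro X hX
  obtain ⟨S, -, huniq⟩ := hA.existsUnique_nbcBase σ hX
  by_cases hS : A.betaNbcBase σ S
  · exact .inl fun T hT hTX => huniq T ⟨hT, hTX⟩ ▸ hS
  · exact .inr fun T hT hTX => huniq T ⟨hT, hTX⟩ ▸ hS

end Normal

theorem map_tup_one (S : Finset (Fin n)) :
    (List.finRange S.card).map (tup 1 S) = S.sort (· ≤ ·) := by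
  refine List.ext_getElem (by simp) fun k _ _ => ?_
  have himage : S.image ⇑(1 : Equiv.Perm (Fin n)) = S := Finset.image_id
  rw [List.getElem_map, tup, Finset.coe_orderIsoOfFin_apply, Finset.orderEmbOfFin_apply]
  simp only [himage, List.getElem_finRange]
  rfl

theorem om_mul_self (A : HArr W n) (i : Fin n) : A.om i * A.om i = 0 := by
  rw [om, ← map_mul, gen, ExteriorAlgebra.ι_sq_zero, map_zero]

theorem om_mul_om_comm (A : HArr W n) (i j : Fin n) :
    A.om i * A.om j = -(A.om j * A.om i) := by
  rw [om, om, ← map_mul, ← map_mul, ← map_neg]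
  exact congrArg _ (eq_neg_of_add_eq_zero_left (ExteriorAlgebra.ι_add_mul_swap _ _))

theorem omB_eq_prod (A : HArr W n) (S : Finset (Fin n)) :
    A.omB S = ((S.sort (· ≤ ·)).map A.om).prod := by
  rw [omB, eS, map_list_prod, List.map_map]
  rfl

end HArr

section Anticommute

variable {ι R : Type*} [Ring R] {f : ι → R}

theorem mul_prod_map_eq_zero_of_mem (hsq : ∀ i, f i * f i = 0)
    (hanti : ∀ i j, f i * f j = -(f j * f i)) {j : ι} {l : List ι} (hj : j ∈ l) :
    f j * (l.map f).prod = 0 := by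
  induction l with
  | nil => simp at hj
  | cons a l ih =>
    rw [List.map_cons, List.prod_cons, ← mul_assoc]
    rcases List.mem_cons.1 hj with rfl | hj
    · rw [hsq, zero_mul]
    · rw [hanti, neg_mul, mul_assoc, ih hj, mul_zero, neg_zero]

/-- A product of decreasing tail sums of anticommuting square-zero elements is the product of
its diagonal terms. -/
theorem prod_map_sum_filter_le [LinearOrder ι] (hsq : ∀ i, f i * f i = 0)
    (hanti : ∀ i j, f i * f j = -(f j * f i)) (S : Finset ι) :
    ((S.sort (· ≤ ·)).map fun a => ∑ i ∈ S with a ≤ i, f i).prod =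
      ((S.sort (· ≤ ·)).map f).prod := by
  induction S using Finset.induction_on_min with
  | empty => simp
  | insert a S ha ih =>
    have hnot : a ∉ S := fun h => (ha a h).false
    have htail : ((S.sort (· ≤ ·)).map fun b => ∑ i ∈ insert a S with b ≤ i, f i) =
        (S.sort (· ≤ ·)).map fun b => ∑ i ∈ S with b ≤ i, f i := by
      refine List.map_congr_left fun b hb => ?_
      rw [Finset.filter_insert, if_neg (ha b ((Finset.mem_sort _).1 hb)).not_ge]
    have hhead : (insert a S).filter (a ≤ ·) = insert a S :=
      Finset.filter_true_of_mem fun i hi => by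
        rcases Finset.mem_insert.1 hi with rfl | hi
        · exact le_rfl
        · exact (ha i hi).le
    rw [Finset.sort_insert (r := (· ≤ ·)) (fun b hb => (ha b hb).le) hnot, List.map_cons,
      List.map_cons, List.prod_cons, List.prod_cons, htail, ih, hhead, Finset.sum_insert hnot, add_mul,
      Finset.sum_mul, Finset.sum_eq_zero, add_zero]
    exact fun j hj => mul_prod_map_eq_zero_of_mem hsq hanti ((Finset.mem_sort _).2 hj)

end Anticommute

theorem List.prod_map_smul_apply {ι K R : Type*} [CommSemiring K] [Semiring R] [Algebra K R]
    (c : ι → K) (f : ι → R) (l : List ι) :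
    (l.map fun i => c i • f i).prod = (l.map c).prod • (l.map f).prod := by
  induction l with
  | nil => simp
  | cons a l ih => simp only [List.map_cons, List.prod_cons, ih, smul_mul_smul_comm]

namespace HArr

variable {W : Type} [AddCommGroup W] [Module ℂ W] {n : ℕ}

theorem Normal.Xi_eq [FiniteDimensional ℂ W] {A : HArr W n} (hA : A.Normal)
    (lam : Fin n → ℂ) {S : Finset (Fin n)} (hS : A.inter S ≠ ⊥) :
    A.Xi 1 lam S = (∏ i ∈ S, lam i) • A.omB S := by
  have hflag : ∀ p, A.omLamX lam (A.flag 1 S p) =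
      ∑ i ∈ S with tup 1 S p ≤ i, lam i • A.om i := by
    intro p
    rw [omLamX, flag,
      hA.sub_inter (A.inter_ne_bot_of_subset (Finset.filter_subset _ _) hS)]
    rfl
  have hXi : A.Xi 1 lam S =
      ((S.sort (· ≤ ·)).map fun a => ∑ i ∈ S with a ≤ i, lam i • A.om i).prod := by
    rw [← map_tup_one, List.map_map, Xi]
    simp only [hflag]
    rfl
  rw [hXi, prod_map_sum_filter_le, List.prod_map_smul_apply, ← omB_eq_prod,
    ← List.prod_toFinset lam (Finset.sort_nodup S (· ≤ ·)), Finset.sort_toFinset]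
  · intro i
    rw [smul_mul_smul_comm, om_mul_self, smul_zero]
  · intro i j
    rw [smul_mul_smul_comm, smul_mul_smul_comm, om_mul_om_comm, smul_neg, mul_comm (lam i)]

end HArr

open scoped Classical
/-- If `𝒜` is normal (`|𝒜_X| = codim X` for all `X ∈ L`), then (a)
`nbc_X` is a singleton for every maximal `X ∈ L` and every linear order on `𝒜` is
unmixed; (b) `Ξ(B) = λ_{i_1} ⋯ λ_{i_r} · ω_B` for every `B ∈ βnbc(𝒜)` and every `λ`. -/
theorem normal_betaNbc {W : Type} [AddCommGroup W] [Module ℂ W]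
    [FiniteDimensional ℂ W] {n : ℕ} (A : HArr W n)
    (hnormal : ∀ X, A.memL X → (A.sub X).card = A.cd X) :
    ((∀ X, A.maximalL X →
        ∃! S : Finset (Fin n), A.nbcBase 1 S ∧ A.inter S = X) ∧
      (∀ σ : Equiv.Perm (Fin n), A.unmixedOrd σ)) ∧
    (∀ lam : Fin n → ℂ, ∀ S : Finset (Fin n), A.betaNbcBase 1 S →
      A.Xi 1 lam S = (∏ i ∈ S, lam i) • A.omB S) := by
  have hA : A.Normal := hnormal
  exact ⟨⟨fun _ => hA.existsUnique_nbcBase 1, hA.unmixedOrd⟩,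
    fun lam _ hS => hA.Xi_eq lam hS.1.1.1⟩
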